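/- Let {g_n} be a sequence in Hol(𝔻, 𝔻) converging uniformly on compact subsets of 𝔻 to a function g ∈ Hol(𝔻, 𝔻) that is not identically zero, and let {h_n} be a sequence in Hol(𝔻, ℂ) such that {g_n h_n} ⊆ Hol(𝔻, 𝔻) converges uniformly on compact subsets of 𝔻 to γ ∈ Hol(𝔻, ℂ). Then the function h := γ/g extends to a holomorphic function on 𝔻 and {h_n} converges uniformly on compact subsets of 𝔻 to h. -/

import Mathlib

open Metric Set Filter Topology

/-- **Lemma (Montel–Hurwitz convergence step).** Let `{g_n} ⊆ Hol(𝔻,𝔻)` converge uniformly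
on compact subsets of `𝔻` to `g ∈ Hol(𝔻,𝔻)` not identically zero, and let
`{h_n} ⊆ Hol(𝔻,ℂ)` be such that `{g_n h_n} ⊆ Hol(𝔻,𝔻)` converges uniformly on compact
subsets of `𝔻` to `γ ∈ Hol(𝔻,ℂ)`. Then `h := γ/g` extends to a holomorphic function on `𝔻`
and `{h_n}` converges uniformly on compact subsets of `𝔻` to `h`. -/
theorem quotient_convergence_step
    (g γ : ℂ → ℂ) (gs hs : ℕ → ℂ → ℂ)
    (hg_hol : ∀ n, DifferentiableOn ℂ (gs n) (ball (0 : ℂ) 1))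
    (hg_maps : ∀ n, MapsTo (gs n) (ball (0 : ℂ) 1) (ball (0 : ℂ) 1))
    (hg_lim : TendstoLocallyUniformlyOn gs g atTop (ball (0 : ℂ) 1))
    (hg_hol' : DifferentiableOn ℂ g (ball (0 : ℂ) 1))
    (hg_maps' : MapsTo g (ball (0 : ℂ) 1) (ball (0 : ℂ) 1))
    (hg_ne : ¬ ∀ z ∈ ball (0 : ℂ) 1, g z = 0)
    (hh_hol : ∀ n, DifferentiableOn ℂ (hs n) (ball (0 : ℂ) 1))
    (hgh_maps : ∀ n, MapsTo (fun z => gs n z * hs n z) (ball (0 : ℂ) 1) (ball (0 : ℂ) 1))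
    (hgh_lim : TendstoLocallyUniformlyOn (fun n z => gs n z * hs n z) γ atTop
      (ball (0 : ℂ) 1))
    (hγ_hol : DifferentiableOn ℂ γ (ball (0 : ℂ) 1)) :
    ∃ h : ℂ → ℂ, DifferentiableOn ℂ h (ball (0 : ℂ) 1) ∧
      (∀ z ∈ ball (0 : ℂ) 1, g z ≠ 0 → h z = γ z / g z) ∧
      TendstoLocallyUniformlyOn hs h atTop (ball (0 : ℂ) 1) := by
  have hloc : ∀ z₀ ∈ ball (0 : ℂ) 1, ∃ r > 0, closedBall z₀ r ⊆ ball (0 : ℂ) 1 ∧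
      UniformCauchySeqOn hs atTop (closedBall z₀ r) := by
    intro z₀ hz₀
    have han : AnalyticOnNhd ℂ g (ball (0 : ℂ) 1) := hg_hol'.analyticOnNhd isOpen_ball
    have hne : ∀ᶠ z in 𝓝[≠] z₀, g z ≠ 0 := by
      refine (han z₀ hz₀).eventually_eq_zero_or_eventually_ne_zero.resolve_left fun h0 => ?_
      exact hg_ne (han.eqOn_zero_of_preconnected_of_eventuallyEq_zero
        (convex_ball (0 : ℂ) 1).isPreconnected hz₀ h0)
    rw [eventually_nhdsWithin_iff] at hne
    obtain ⟨r, hr, hrs⟩ := Metric.nhds_basis_closedBall.mem_iff.mp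
      (hne.and (isOpen_ball.mem_nhds hz₀))
    have hsub : closedBall z₀ r ⊆ ball (0 : ℂ) 1 := fun z hz => (hrs hz).2
    have hsph : sphere z₀ r ⊆ ball (0 : ℂ) 1 := sphere_subset_closedBall.trans hsub
    have hgne : ∀ z ∈ sphere z₀ r, g z ≠ 0 := fun z hz =>
      (hrs (sphere_subset_closedBall hz)).1 (ne_of_mem_sphere hz hr.ne')
    have hcpt : IsCompact (sphere z₀ r) := isCompact_sphere z₀ r
    have hgc : ContinuousOn g (sphere z₀ r) := hg_hol'.continuousOn.mono hsph
    have hγc : ContinuousOn γ (sphere z₀ r) := hγ_hol.continuousOn.mono hsph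
    have hgu : TendstoUniformlyOn gs g atTop (sphere z₀ r) :=
      (tendstoLocallyUniformlyOn_iff_tendstoUniformlyOn_of_compact hcpt).1 (hg_lim.mono hsph)
    obtain ⟨c, hc, hcle⟩ := hcpt.exists_forall_le' (f := fun z => ‖g z‖) hgc.norm
      (a := 0) (fun z hz => norm_pos_iff.2 (hgne z hz))
    have hev : ∀ᶠ n in atTop, ∀ z ∈ sphere z₀ r, gs n z ≠ 0 := by
      filter_upwards [Metric.tendstoUniformlyOn_iff.1 hgu c hc] with n hn z hz h0
      have h1 := hn z hz
      rw [h0, dist_zero_right] at h1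
      exact absurd (hcle z hz) (not_le.2 h1)
    have hq : TendstoUniformlyOn hs (γ / g) atTop (sphere z₀ r) := by
      have h1 := (tendstoLocallyUniformlyOn_iff_tendstoUniformlyOn_of_compact hcpt).1
        ((hgh_lim.mono hsph).div₀ (hg_lim.mono hsph) hγc hgc hgne)
      refine h1.congr ?_
      filter_upwards [hev] with n hn z hz
      have := hn z hz
      simp only [Pi.div_apply]
      field_simp
    refine ⟨r, hr, hsub, ?_⟩
    rw [Metric.uniformCauchySeqOn_iff]
    intro ε hε
    obtain ⟨N, hN⟩ := Metric.uniformCauchySeqOn_iff.1 hq.uniformCauchySeqOn (ε / 2) (half_pos hε)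
    refine ⟨N, fun m hm n hn z hz => ?_⟩
    have hd : DifferentiableOn ℂ (fun w => hs m w - hs n w) (closure (ball z₀ r)) := by
      rw [closure_ball z₀ hr.ne']
      exact ((hh_hol m).sub (hh_hol n)).mono hsub
    have hle := Complex.norm_le_of_forall_mem_frontier_norm_le (isBounded_ball (x := z₀) (r := r))
      hd.diffContOnCl (C := ε / 2) (fun w hw => by
        rw [frontier_ball z₀ hr.ne'] at hw
        have := hN m hm n hn w hw
        rw [dist_eq_norm] at this
        exact this.le) (z := z) (by rwa [closure_ball z₀ hr.ne'])
    rw [dist_eq_norm]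
    exact lt_of_le_of_lt hle (half_lt_self hε)
  have hpt : ∀ z, ∃ a, z ∈ ball (0 : ℂ) 1 → Tendsto (fun n => hs n z) atTop (𝓝 a) := by
    intro z
    by_cases hz : z ∈ ball (0 : ℂ) 1
    · obtain ⟨r, hr, -, hC⟩ := hloc z hz
      obtain ⟨a, ha⟩ := cauchySeq_tendsto_of_complete
        (hC.cauchySeq (mem_closedBall_self hr.le))
      exact ⟨a, fun _ => ha⟩
    · exact ⟨0, fun h => absurd h hz⟩
  choose h hh using hpt
  have hlim : TendstoLocallyUniformlyOn hs h atTop (ball (0 : ℂ) 1) := by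
    intro u hu z hz
    obtain ⟨r, hr, hsub, hC⟩ := hloc z hz
    exact ⟨closedBall z r, mem_nhdsWithin_of_mem_nhds (closedBall_mem_nhds z hr),
      hC.tendstoUniformlyOn_of_tendsto (fun w hw => hh w (hsub hw)) u hu⟩
  refine ⟨h, hlim.differentiableOn (Eventually.of_forall hh_hol) isOpen_ball, ?_, hlim⟩
  intro z hz hgz
  rw [eq_div_iff hgz, mul_comm]
  exact tendsto_nhds_unique ((hg_lim.tendsto_at hz).mul (hh z hz)) (hgh_lim.tendsto_at hz)
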